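/- Let F = G1 ∗ ⋯ ∗ G_m be the free product of m ≥ 3 nontrivial groups, fix nontrivial g_α ∈ G_α, set w_α := g_{α+1}⋯g_m·g_1⋯g_α, and let μ: F → F be the homomorphism with μ(a) = w_α⁻¹ a w_α for a ∈ G_α. If H is a factor-free subgroup of F, then μ(H) is a factor-free subgroup of F, and moreover μ(H) is factor-free with respect to the two-factor decomposition F = G_1 ∗ G(2,m): for every s ∈ F, μ(H) ∩ s G_1 s⁻¹ = {1} and μ(H) ∩ s G(2,m) s⁻¹ = {1}, where G(2,m) is the subgroup of F generated by G_2, …, G_m. -/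

import Mathlib

open Monoid

section Defs

variable {F : Type} [Group F]

def conjS (t : F) (K : Subgroup F) : Subgroup F := K.map (MulAut.conj t).toMonoidHom

noncomputable def rk (H : Subgroup F) : ℕ :=
  sInf {n : ℕ | ∃ S : Finset F, S.card = n ∧ Subgroup.closure (S : Set F) = H}

noncomputable def rrk (H : Subgroup F) : ℕ := rk H - 1

def dcSetoid (H K : Subgroup F) : Setoid F where
  r s t := ∃ h ∈ H, ∃ k ∈ K, h * s * k = t
  iseqv := by
    refine ⟨fun s => ⟨1, H.one_mem, 1, K.one_mem, by group⟩, ?_, ?_⟩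
    · rintro s t ⟨h, hh, k, hk, rfl⟩
      exact ⟨h⁻¹, H.inv_mem hh, k⁻¹, K.inv_mem hk, by group⟩
    · rintro s t u ⟨h, hh, k, hk, rfl⟩ ⟨h', hh', k', hk', rfl⟩
      exact ⟨h' * h, H.mul_mem hh' hh, k * k', K.mul_mem hk hk', by group⟩

noncomputable def rrkInter (H K : Subgroup F) : ℕ :=
  finsum fun q : Quotient (dcSetoid H K) => rrk (H ⊓ conjS q.out K)

def Noncyclic (H : Subgroup F) : Prop := ∀ g : F, H ≠ Subgroup.closure {g}

end Defs

section Mu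

variable {m : ℕ} {G : Fin m → Type} [∀ i, Group (G i)]

/-- A subgroup of the free product `∗_α G_α` is factor-free if it meets every conjugate
of every factor trivially. -/
def FactorFreeI (H : Subgroup (CoprodI G)) : Prop :=
  ∀ (s : CoprodI G) (i : Fin m),
    H ⊓ conjS s (CoprodI.of : G i →* CoprodI G).range = ⊥

/-- The element `w_α = g_{α+1} ⋯ g_m · g_1 ⋯ g_α` of `F = G_1 ∗ ⋯ ∗ G_m`:
the cyclic permutation of the word `g_1 g_2 ⋯ g_m` beginning right after `g_α`. -/
def wcyc (g : ∀ i, G i) (α : Fin m) : CoprodI G :=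
  ((List.ofFn fun i => CoprodI.of (g i)).drop (α.1 + 1)).prod *
    ((List.ofFn fun i => CoprodI.of (g i)).take (α.1 + 1)).prod

/-- The length `|W|` of an element of the free product: the number of letters of the
unique reduced word representing it. -/
noncomputable def wlen (w : CoprodI G) : ℕ :=
  letI : ∀ i, DecidableEq (G i) := fun _ => Classical.decEq _
  (CoprodI.Word.equiv w).toList.length

/-- `W` is cyclically reduced: the reduced word representing `W²` has length `2|W|`. -/
def CyclRed (w : CoprodI G) : Prop := wlen (w * w) = 2 * wlen w

/-- The image of the factor `G_i` in the free product. -/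
def factorRange (i : Fin m) : Subgroup (CoprodI G) :=
  (CoprodI.of : G i →* CoprodI G).range

/-- The subgroup `G(2,m)` of `F` generated by all the factors other than `G_{i0}`. -/
def tailSub (i0 : Fin m) : Subgroup (CoprodI G) :=
  ⨆ (i : Fin m) (_ : i ≠ i0), (factorRange i : Subgroup (CoprodI G))

end Mu

namespace Monoid.CoprodI

variable {ι : Type*}

section LetterCount

variable {M : ι → Type*} [∀ i, Monoid (M i)]

open Classical in
/-- The number of letters of the reduced word of `x` whose index satisfies `p`. -/
noncomputable def letterCount (p : ι → Bool) (x : CoprodI M) : ℕ :=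
  (Word.equiv x).toList.countP fun l => p l.1

theorem letterCount_prod (p : ι → Bool) (w : Word M) :
    letterCount p w.prod = w.toList.countP fun l => p l.1 := by
  classical
  have h : Word.equiv w.prod = w := Word.equiv.apply_symm_apply w
  unfold letterCount
  convert rfl using 3
  convert h.symm

theorem letterCount_neWord_prod (p : ι → Bool) {i j : ι} (w : NeWord M i j) :
    letterCount p w.prod = w.toList.countP fun l => p l.1 :=
  letterCount_prod p w.toWord

theorem exists_word_prod_eq (x : CoprodI M) : ∃ w : Word M, w.prod = x := by
  classical
  exact ⟨Word.equiv x, Word.equiv.symm_apply_apply x⟩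

theorem eq_one_or_exists_neWord_prod_eq (x : CoprodI M) :
    x = 1 ∨ ∃ (i j : ι) (v : NeWord M i j), v.prod = x := by
  obtain ⟨w, rfl⟩ := exists_word_prod_eq x
  by_cases hw : w = .empty
  · exact .inl (by rw [hw, Word.prod_empty])
  · obtain ⟨i, j, v, rfl⟩ := NeWord.of_word w hw
    exact .inr ⟨i, j, v, rfl⟩

@[simp]
theorem letterCount_one (p : ι → Bool) : letterCount p (1 : CoprodI M) = 0 := by
  rw [← Word.prod_empty, letterCount_prod]
  rfl

theorem letterCount_of_mul_le (p : ι → Bool) {i : ι} (a : M i) (x : CoprodI M) :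
    letterCount p (of a * x) ≤ (if p i then 1 else 0) + letterCount p x := by
  classical
  obtain ⟨w, rfl⟩ := exists_word_prod_eq x
  obtain ⟨q, rfl⟩ := (Word.equivPair i).symm.surjective w
  have hq : ∀ r : Word.Pair M i, letterCount p (Word.rcons r).prod ≤
        (if p i then 1 else 0) + letterCount p r.tail.prod ∧
      letterCount p r.tail.prod ≤ letterCount p (Word.rcons r).prod := by
    intro r
    rw [letterCount_prod, letterCount_prod]
    unfold Word.rcons
    split_ifs <;> simp_all [Word.cons]
  have h := (hq ⟨a * q.head, q.tail, q.fstIdx_ne⟩).1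
  rw [Word.prod_rcons, map_mul, mul_assoc, ← Word.prod_rcons] at h
  rw [Word.equivPair_symm]
  exact h.trans (Nat.add_le_add_left (hq q).2 _)

theorem letterCount_list_prod_mul_le (p : ι → Bool) (l : List (Σ i, M i)) (x : CoprodI M) :
    letterCount p ((l.map fun a => of a.2).prod * x) ≤
      (l.countP fun a => p a.1) + letterCount p x := by
  induction l with
  | nil => simp
  | cons a l ih =>
    have h := letterCount_of_mul_le p a.2 ((l.map fun a => of a.2).prod * x)
    simp only [List.map_cons, List.prod_cons, mul_assoc, List.countP_cons]
    omega

theorem letterCount_list_prod_le (p : ι → Bool) (l : List (Σ i, M i)) :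
    letterCount p (l.map fun a => of a.2).prod ≤ l.countP fun a => p a.1 := by
  simpa using letterCount_list_prod_mul_le p l 1

theorem letterCount_mul_le (p : ι → Bool) (x y : CoprodI M) :
    letterCount p (x * y) ≤ letterCount p x + letterCount p y := by
  obtain ⟨w, rfl⟩ := exists_word_prod_eq x
  rw [letterCount_prod]
  exact letterCount_list_prod_mul_le p w.toList y

theorem letterCount_of_le (p : ι → Bool) {i : ι} (a : M i) :
    letterCount p (of a) ≤ if p i then 1 else 0 := by
  simpa using letterCount_of_mul_le p a 1

end LetterCount

section Group

variable {G : ι → Type*} [∀ i, Group (G i)]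

theorem NeWord.exists_prod_eq_pow {i j : ι} (w : NeWord G i j) (hij : j ≠ i) (n : ℕ) :
    ∃ v : NeWord G i j, v.prod = w.prod ^ (n + 1) ∧ n + 1 ≤ v.toList.length := by
  induction n with
  | zero =>
    exact ⟨w, by simp, List.length_pos_of_ne_nil w.toList_ne_nil⟩
  | succ n ih =>
    obtain ⟨v, hv, hl⟩ := ih
    have := List.length_pos_of_ne_nil w.toList_ne_nil
    exact ⟨.append v hij w, by rw [NeWord.append_prod, hv, pow_succ _ (n + 1)], by simp; omega⟩

/-- Up to conjugation, an element of a free product is trivial, lies in a factor, or is given by a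
cyclically reduced word of length at least two. -/
theorem exists_conj_eq_of_or_neWord (x : CoprodI G) :
    x = 1 ∨ (∃ (s : CoprodI G) (i : ι) (a : G i), x = s * of a * s⁻¹) ∨
      ∃ (s : CoprodI G) (i j : ι) (w : NeWord G i j), j ≠ i ∧ x = s * w.prod * s⁻¹ := by
  induction hn : letterCount (fun _ => true) x using Nat.strong_induction_on generalizing x with
  | _ n ih =>
  obtain rfl | ⟨i, j, v, rfl⟩ := eq_one_or_exists_neWord_prod_eq x
  · exact .inl rfl
  by_cases hij : j = i
  swap
  · exact .inr (.inr ⟨1, i, j, v, hij, by simp⟩)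
  subst hij
  have hc := letterCount_neWord_prod (fun _ => true) v
  have hprod : v.prod = (v.toList.map fun l => of l.2).prod := rfl
  have hhead := v.toList_head?
  have hlast := v.toList_getLast?
  rcases hl : v.toList with - | ⟨a, t⟩
  · exact absurd hl v.toList_ne_nil
  rw [hl] at hhead hlast hprod hc
  obtain rfl : a = ⟨j, v.head⟩ := by simpa using hhead
  rcases List.eq_nil_or_concat' t with rfl | ⟨t, b, rfl⟩
  · exact .inr (.inl ⟨1, j, v.head, by simp [hprod]⟩)
  obtain rfl : b = ⟨j, v.last⟩ := by simpa [List.getLast?_cons] using hlast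
  have hconj : v.prod = of v.head *
      ((t ++ [(⟨j, v.last * v.head⟩ : Σ i, G i)]).map fun l => of l.2).prod * (of v.head)⁻¹ := by
    simp [hprod, mul_assoc]
  have hlt := letterCount_list_prod_le (fun _ => true) (t ++ [(⟨j, v.last * v.head⟩ : Σ i, G i)])
  rw [hn] at hc
  simp only [List.countP_true, List.length_append, List.length_cons, List.length_nil] at hlt hc
  rcases ih _ (hlt.trans_lt (by omega)) _ rfl with h | ⟨s, i, a, h⟩ | ⟨s, i, k, w, hk, h⟩
  · left
    rw [hconj, h]
    group
  · refine .inr (.inl ⟨of v.head * s, i, a, ?_⟩)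
    rw [hconj, h]
    group
  · refine .inr (.inr ⟨of v.head * s, i, k, w, hk, ?_⟩)
    rw [hconj, h]
    group

/-- If the total numbers of letters of the powers of `x` are bounded, then `x` is trivial or
conjugate into a factor. -/
theorem eq_one_or_exists_conj_of_letterCount_pow_le {x : CoprodI G} {C : ℕ}
    (hx : ∀ n : ℕ, letterCount (fun _ => true) (x ^ n) ≤ C) :
    x = 1 ∨ ∃ (s : CoprodI G) (i : ι) (a : G i), x = s * of a * s⁻¹ := by
  rcases exists_conj_eq_of_or_neWord x with h | h | ⟨s, i, j, w, hij, rfl⟩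
  · exact .inl h
  · exact .inr h
  obtain ⟨v, hv, hl⟩ := w.exists_prod_eq_pow hij
    (C + letterCount (fun _ => true) s + letterCount (fun _ => true) s⁻¹)
  have h := letterCount_neWord_prod (fun _ => true) v
  rw [List.countP_true, hv] at h
  have h₁ := hx (C + letterCount (fun _ => true) s + letterCount (fun _ => true) s⁻¹ + 1)
  rw [conj_pow] at h₁
  set y := w.prod ^ (C + letterCount (fun _ => true) s + letterCount (fun _ => true) s⁻¹ + 1)
  have h₂ := letterCount_mul_le (fun _ => true) s⁻¹ (s * y * s⁻¹ * s)
  have h₃ := letterCount_mul_le (fun _ => true) (s * y * s⁻¹) s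
  rw [show s⁻¹ * (s * y * s⁻¹ * s) = y by group] at h₂
  omega

/-- A homomorphism conjugating each factor `G i` by a reduced word that ends in `G i`, does not
start in `G i` and has a letter with index in `p` does not decrease lengths. -/
theorem letterCount_le_letterCount_map (p : ι → Bool) (μ : CoprodI G →* CoprodI G)
    (hμ : ∀ i, ∃ (j : ι) (u : NeWord G j i), j ≠ i ∧ 1 ≤ letterCount p u.prod ∧
      ∀ a : G i, μ (of a) = u.prod⁻¹ * of a * u.prod) (x : CoprodI G) :
    letterCount (fun _ => true) x ≤ letterCount p (μ x) := by
  have key : ∀ {i j : ι} (w : NeWord G i j), ∃ v : NeWord G i j, v.prod = μ w.prod ∧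
      w.toList.length ≤ v.toList.countP fun l => p l.1 := by
    intro i j w
    induction w with
    | @singleton i a ha =>
      obtain ⟨j, u, hj, hu, h⟩ := hμ i
      rw [letterCount_neWord_prod] at hu
      refine ⟨.append (.append u.inv hj (.singleton a ha)) hj.symm u, by simp [h], ?_⟩
      simp only [NeWord.toList, List.countP_append, List.length_singleton]
      omega
    | append w₁ hne w₂ ih₁ ih₂ =>
      obtain ⟨v₁, h₁, hl₁⟩ := ih₁
      obtain ⟨v₂, h₂, hl₂⟩ := ih₂
      refine ⟨.append v₁ hne v₂, by simp [h₁, h₂], ?_⟩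
      simp only [NeWord.toList, List.countP_append, List.length_append]
      omega
  obtain rfl | ⟨i, j, v, rfl⟩ := eq_one_or_exists_neWord_prod_eq x
  · simp
  obtain ⟨v', h, hl⟩ := key v
  rwa [← h, letterCount_neWord_prod, letterCount_neWord_prod, List.countP_true]

/-- If `H` meets all conjugates of factors trivially and `μ` does not decrease lengths, then `μ(H)`
meets trivially all conjugates of a subgroup `K` whose elements have boundedly many letters with
index in `p`. -/
theorem map_inf_map_conj_eq_bot (p : ι → Bool) {μ : CoprodI G →* CoprodI G}
    (hμ : ∀ x, letterCount (fun _ => true) x ≤ letterCount p (μ x))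
    {H : Subgroup (CoprodI G)}
    (hH : ∀ (s : CoprodI G) (i : ι),
      H ⊓ (of : G i →* CoprodI G).range.map (MulAut.conj s).toMonoidHom = ⊥)
    {K : Subgroup (CoprodI G)} {C : ℕ} (hK : ∀ x ∈ K, letterCount p x ≤ C) (s : CoprodI G) :
    H.map μ ⊓ K.map (MulAut.conj s).toMonoidHom = ⊥ := by
  rw [eq_bot_iff]
  rintro _ ⟨⟨h, hh, rfl⟩, k, hk, hkh⟩
  replace hkh : s * k * s⁻¹ = μ h := hkh
  suffices h = 1 by simp [this]
  have hb : ∀ n : ℕ, letterCount (fun _ => true) (h ^ n) ≤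
      letterCount p s + C + letterCount p s⁻¹ := by
    intro n
    have h₁ := hμ (h ^ n)
    rw [map_pow, ← hkh, conj_pow] at h₁
    have h₂ := letterCount_mul_le p (s * k ^ n) s⁻¹
    have h₃ := letterCount_mul_le p s (k ^ n)
    have h₄ := hK _ (K.pow_mem hk n)
    omega
  rcases eq_one_or_exists_conj_of_letterCount_pow_le hb with h₁ | ⟨t, i, a, h₁⟩
  · exact h₁
  · have : h ∈ H ⊓ (of : G i →* CoprodI G).range.map (MulAut.conj t).toMonoidHom :=
      ⟨hh, of a, ⟨a, rfl⟩, h₁.symm⟩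
    rwa [hH, Subgroup.mem_bot] at this

end Group

end Monoid.CoprodI

/-- `wcyc g α` is given by a reduced word ending in `G α`, not starting in `G α`, and containing a
letter of every factor. -/
theorem exists_neWord_prod_eq_wcyc {m : ℕ} (hm : 2 ≤ m) {G : Fin m → Type} [∀ i, Group (G i)]
    (g : ∀ i, G i) (hg : ∀ i, g i ≠ 1) (k α : Fin m) :
    ∃ (j : Fin m) (u : CoprodI.NeWord G j α), j ≠ α ∧
      1 ≤ CoprodI.letterCount (fun i => decide (i = k)) u.prod ∧ u.prod = wcyc g α := by
  set l := (List.finRange m).drop (α.1 + 1) ++ (List.finRange m).take α.1 with hl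
  have hcyc : (List.finRange m).drop (α.1 + 1) ++ (List.finRange m).take (α.1 + 1) = l ++ [α] := by
    rw [List.take_succ_eq_append_getElem (by simp), hl, List.append_assoc]
    simp
  have hperm : (l ++ [α]).Perm (List.finRange m) := by
    rw [← hcyc]
    exact List.perm_append_comm.trans (by rw [List.take_append_drop])
  have hnodup : (l ++ [α]).Nodup := hperm.nodup_iff.2 (List.nodup_finRange m)
  let f : Fin m → Σ i, G i := fun i => ⟨i, g i⟩
  let w : CoprodI.Word G :=
    { toList := (l ++ [α]).map f
      ne_one := by
        intro a ha
        obtain ⟨i, -, rfl⟩ := List.mem_map.1 ha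
        exact hg i
      chain_ne := by
        rw [List.isChain_map]
        exact hnodup.isChain }
  obtain ⟨j, i, u, hu⟩ := CoprodI.NeWord.of_word w (by
    intro h
    have := congrArg CoprodI.Word.toList h
    simp [w, CoprodI.Word.empty] at this)
  have htl : u.toList = (l ++ [α]).map f := congrArg CoprodI.Word.toList hu
  have hprod : u.prod = wcyc g α := by
    rw [CoprodI.NeWord.prod, hu]
    simp only [CoprodI.Word.prod, w, ← hcyc, wcyc, List.ofFn_eq_map, List.map_append,
      List.prod_append, List.map_drop, List.map_take, List.map_map]
    rfl
  have hlast := u.toList_getLast?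
  have hhead := u.toList_head?
  rw [htl] at hlast hhead
  obtain rfl : α = i := by
    simp only [List.map_append, List.map_cons, List.map_nil, List.getLast?_append,
      List.getLast?_singleton, Option.some_or, Option.some.injEq] at hlast
    exact congrArg Sigma.fst hlast
  refine ⟨j, u, ?_, ?_, hprod⟩
  · rcases hl' : l with - | ⟨b, t⟩
    · have := hperm.length_eq
      simp [hl'] at this
      omega
    rw [hl'] at hhead hnodup
    obtain rfl : b = j := by
      simp only [List.cons_append, List.map_cons, List.head?_cons, Option.some.injEq] at hhead
      exact congrArg Sigma.fst hhead
    rintro rfl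
    simp at hnodup
  · rw [CoprodI.letterCount_neWord_prod, htl, Nat.one_le_iff_ne_zero, Nat.ne_zero_iff_zero_lt,
      List.countP_pos_iff]
    exact ⟨f k, List.mem_map_of_mem (hperm.mem_iff.2 (List.mem_finRange k)), by simp [f]⟩

theorem letterCount_eq_zero_of_mem_tailSub {m : ℕ} {G : Fin m → Type} [∀ i, Group (G i)]
    {k : Fin m} {x : CoprodI G} (hx : x ∈ tailSub (G := G) k) :
    CoprodI.letterCount (fun i => decide (i = k)) x = 0 := by
  rw [tailSub, iSup_subtype'] at hx
  refine Subgroup.iSup_induction _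
    (C := fun x => CoprodI.letterCount (fun i => decide (i = k)) x = 0) hx ?_ (by simp) ?_
  · rintro ⟨i, hi⟩ _ ⟨a, rfl⟩
    simpa [hi] using CoprodI.letterCount_of_le (fun i => decide (i = k)) a
  · intro x y hx hy
    have := CoprodI.letterCount_mul_le (fun i => decide (i = k)) x y
    omega

/-- Lemma 5.3(c): if `H` is a factor-free subgroup of `F`, then `μ(H)` is
factor-free in `F`, and is also factor-free with respect to the two-factor decomposition
`F = G_1 ∗ G(2,m)`. -/
theorem statement13 {m : ℕ} (hm : 3 ≤ m) {G : Fin m → Type} [∀ i, Group (G i)]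
    [∀ i, Nontrivial (G i)] (g : ∀ i, G i) (hg : ∀ i, g i ≠ 1)
    (μ : CoprodI G →* CoprodI G)
    (hμ : ∀ (α : Fin m) (a : G α),
      μ (CoprodI.of a) = (wcyc g α)⁻¹ * CoprodI.of a * wcyc g α)
    (H : Subgroup (CoprodI G)) (hH : FactorFreeI H) :
    FactorFreeI (H.map μ) ∧
      ∀ s : CoprodI G,
        (H.map μ) ⊓ conjS s (factorRange (G := G) ⟨0, by omega⟩) = ⊥ ∧
        (H.map μ) ⊓ conjS s (tailSub (G := G) ⟨0, by omega⟩) = ⊥ := by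
  set k : Fin m := ⟨0, by omega⟩
  have hlen := CoprodI.letterCount_le_letterCount_map (fun i => decide (i = k)) μ fun i => by
    obtain ⟨j, u, hj, hu, h⟩ := exists_neWord_prod_eq_wcyc (by omega) g hg k i
    exact ⟨j, u, hj, hu, fun a => by rw [h, hμ]⟩
  have hfactor : ∀ (s : CoprodI G) (i : Fin m),
      H.map μ ⊓ conjS s (CoprodI.of : G i →* CoprodI G).range = ⊥ := fun s i => by
    refine CoprodI.map_inf_map_conj_eq_bot _ hlen hH (C := 1) ?_ s
    rintro _ ⟨a, rfl⟩
    exact (CoprodI.letterCount_of_le _ a).trans (by split_ifs <;> simp)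
  exact ⟨hfactor, fun s => ⟨hfactor s k, CoprodI.map_inf_map_conj_eq_bot _ hlen hH (C := 0)
    (fun x hx => (letterCount_eq_zero_of_mem_tailSub hx).le) s⟩⟩
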